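/- Let Γ be a finite connected non-complete graph of prime valency p that is 2-geodesic transitive but not 2-arc transitive. Then for every vertex v, there is exactly one vertex at distance 3 from v, and the diameter of Γ is 3. -/

import Mathlib

open SimpleGraph

/-- `Γ` is arc transitive: its automorphism group is transitive on ordered pairs
of adjacent vertices. -/
def ArcTransitive {V : Type*} (Γ : SimpleGraph V) : Prop :=
  ∀ ⦃v u v' u' : V⦄, Γ.Adj v u → Γ.Adj v' u' →
    ∃ φ : Γ ≃g Γ, φ v = v' ∧ φ u = u'

/-- `(v,u,w)` is a 2-arc of `Γ`. -/
def Is2Arc {V : Type*} (Γ : SimpleGraph V) (v u w : V) : Prop :=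
  Γ.Adj v u ∧ Γ.Adj u w ∧ v ≠ w

/-- `(v,u,w)` is a 2-geodesic of `Γ`: a 2-arc with `v`, `w` non-adjacent. -/
def Is2Geodesic {V : Type*} (Γ : SimpleGraph V) (v u w : V) : Prop :=
  Γ.Adj v u ∧ Γ.Adj u w ∧ v ≠ w ∧ ¬ Γ.Adj v w

/-- `Γ` is 2-arc transitive: arc transitive and transitive on 2-arcs. -/
def TwoArcTransitive {V : Type*} (Γ : SimpleGraph V) : Prop :=
  ArcTransitive Γ ∧
  ∀ ⦃v u w v' u' w' : V⦄, Is2Arc Γ v u w → Is2Arc Γ v' u' w' →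
    ∃ φ : Γ ≃g Γ, φ v = v' ∧ φ u = u' ∧ φ w = w'

/-- `Γ` is 2-geodesic transitive: arc transitive and transitive on 2-geodesics. -/
def TwoGeodesicTransitive {V : Type*} (Γ : SimpleGraph V) : Prop :=
  ArcTransitive Γ ∧
  ∀ ⦃v u w v' u' w' : V⦄, Is2Geodesic Γ v u w → Is2Geodesic Γ v' u' w' →
    ∃ φ : Γ ≃g Γ, φ v = v' ∧ φ u = u' ∧ φ w = w'

open Polynomial in
/-- Summing the shifts of a polynomial of degree `d < p` over a set whose power sums of order
`1, …, r - 1` vanish, but not the one of order `r ≤ d`, cannot give a multiple of it. -/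
theorem natDegree_lt_of_sum_shift_eq {p : ℕ} [Fact p.Prime] (U : Finset (ZMod p)) (r : ℕ)
    (hr0 : 0 < r) (hw : ∀ j, 0 < j → j < r → ∑ u ∈ U, u ^ j = 0) (hwr : ∑ u ∈ U, u ^ r ≠ 0)
    (P : (ZMod p)[X]) (hP : P.natDegree < p)
    (h : ∀ x, ∑ u ∈ U, P.eval (x + u) = ∑ _u ∈ U, P.eval x) : P.natDegree < r := by
  by_contra! hd
  set d := P.natDegree with hdd
  have hP0 : P ≠ 0 := by
    rintro rfl
    simp at hdd
    omega
  set Q : (ZMod p)[X] := ∑ u ∈ U, (taylor u P - P) with hQ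
  have hQ0 : Q = 0 := by
    apply Polynomial.eq_zero_of_natDegree_lt_card_of_eval_eq_zero Q
      (f := fun x : ZMod p => x) Function.injective_id
    · intro x
      simp only [hQ, eval_finsetSum, eval_sub, taylor_eval, Finset.sum_sub_distrib]
      rw [← h x, sub_self]
    · rw [ZMod.card]
      refine lt_of_le_of_lt (natDegree_sum_le_of_forall_le (n := d) U _ ?_) hP
      intro u _
      refine (natDegree_sub_le _ _).trans ?_
      simp [natDegree_taylor, hdd]
  have hc : Q.coeff (d - r) = 0 := by rw [hQ0, coeff_zero]
  have hev : ∀ u : ZMod p, (hasseDeriv (d - r) P).eval u =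
      ∑ j ∈ Finset.range (r + 1), (hasseDeriv (d - r) P).coeff j * u ^ j := by
    intro u
    apply eval_eq_sum_range'
    have := natDegree_hasseDeriv_le P (d - r)
    omega
  simp only [hQ, finsetSum_coeff, coeff_sub, taylor_coeff, Finset.sum_sub_distrib, hev] at hc
  rw [Finset.sum_comm, Finset.sum_range_succ, ← Finset.mul_sum,
    Finset.sum_eq_single_of_mem 0 (by simpa using hr0)] at hc
  · simp only [hasseDeriv_coeff, pow_zero, mul_one, zero_add, Nat.choose_self, Nat.cast_one,
      one_mul, add_sub_cancel_left] at hc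
    rw [show r + (d - r) = d by omega] at hc
    simp only [mul_eq_zero, hwr, or_false] at hc
    rcases hc with hc | hc
    · rw [ZMod.natCast_eq_zero_iff] at hc
      have h1 : p ∣ d.factorial := by
        rw [← Nat.choose_mul_factorial_mul_factorial (Nat.sub_le d r), mul_assoc]
        exact hc.mul_right _
      exact absurd ((Fact.out : p.Prime).dvd_factorial.1 h1) (by omega)
    · exact hP0 (leadingCoeff_eq_zero.1 hc)
  · intro j hj hj0
    rw [← Finset.mul_sum, hw j (by omega) (by simpa using hj), mul_zero]


open Polynomial in
/-- A nonempty set of nonzero field elements has a nonzero power sum of some order between `1`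
and its size. -/
theorem exists_sum_pow_ne_zero {F : Type*} [Field F] (U : Finset F) (h0 : (0 : F) ∉ U)
    (hne : U.Nonempty) : ∃ r, 0 < r ∧ r ≤ U.card ∧ ∑ u ∈ U, u ^ r ≠ 0 := by
  classical
  by_contra! hw
  obtain ⟨a, ha⟩ := hne
  set q : F[X] := ∏ u ∈ U.erase a, (X - C u) with hq
  have hdeg : q.natDegree < U.card := by
    rw [hq, natDegree_prod_of_monic _ _ fun u _ => monic_X_sub_C u]
    simp only [natDegree_X_sub_C, Finset.sum_const, smul_eq_mul, mul_one]
    exact Finset.card_erase_lt_of_mem ha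
  have h1 : ∑ u ∈ U, u * q.eval u = 0 := by
    simp only [eval_eq_sum_range' hdeg, Finset.mul_sum]
    rw [Finset.sum_comm]
    refine Finset.sum_eq_zero fun i hi => ?_
    rw [Finset.sum_congr rfl fun u _ => show u * (q.coeff i * u ^ i) = q.coeff i * u ^ (i + 1) by
      ring, ← Finset.mul_sum, hw (i + 1) (by omega) (by simpa using hi), mul_zero]
  rw [Finset.sum_eq_single_of_mem a ha] at h1
  · simp only [hq, eval_prod, eval_sub, eval_X, eval_C, mul_eq_zero, Finset.prod_eq_zero_iff,
      sub_eq_zero] at h1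
    rcases h1 with rfl | ⟨b, hb, rfl⟩
    · exact h0 ha
    · simp at hb
  · intro b hb hba
    rw [hq, eval_prod, Finset.prod_eq_zero (i := b)]
    · simp
    · simp [hb, hba]
    · simp

open Polynomial in
theorem exists_affine_of_card_le {p : ℕ} [Fact p.Prime] (hp2 : p ≠ 2) (U : Finset (ZMod p))
    (h0 : (0 : ZMod p) ∉ U) (hne : U.Nonempty) (hneg : ∀ u ∈ U, -u ∈ U)
    (hcard : 2 * U.card ≤ p - 1) (π : Equiv.Perm (ZMod p))
    (hπ : ∀ x y, x - y ∈ U ↔ π x - π y ∈ U) : ∃ a b, ∀ x, π x = a * x + b := by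
  classical
  have hp := (Fact.out : p.Prime)
  have hex := exists_sum_pow_ne_zero U h0 hne
  set r := Nat.find hex with hr
  obtain ⟨hr0, hrU, hwr⟩ : 0 < r ∧ r ≤ U.card ∧ ∑ u ∈ U, u ^ r ≠ 0 := Nat.find_spec hex
  have hw : ∀ j, 0 < j → j < r → ∑ u ∈ U, u ^ j = 0 := by
    intro j hj0 hjr
    by_contra hj
    exact Nat.find_min hex hjr ⟨hj0, by omega, hj⟩
  have hr1 : r ≠ 1 := by
    intro h1
    rw [h1] at hwr
    have h2 : ∑ u ∈ U, u = ∑ u ∈ U, -u :=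
      Finset.sum_nbij' (fun u => -u) (fun u => -u) hneg hneg (by simp) (by simp) (by simp)
    simp only [pow_one] at hwr
    rw [Finset.sum_neg_distrib] at h2
    have h3 : (2 : ZMod p) * ∑ u ∈ U, u = 0 := by linear_combination h2
    rcases mul_eq_zero.1 h3 with h4 | h4
    · have : ((2 : ℕ) : ZMod p) = 0 := by exact_mod_cast h4
      rw [ZMod.natCast_eq_zero_iff] at this
      exact hp2 ((Nat.prime_dvd_prime_iff_eq hp Nat.prime_two).1 this)
    · exact hwr h4
  set f : (ZMod p)[X] := Lagrange.interpolate Finset.univ id π with hf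
  have hfe : ∀ x, f.eval x = π x := fun x =>
    Lagrange.eval_interpolate_at_node (v := id) π (Set.injOn_id _) (Finset.mem_univ x)
  have hfd : f.natDegree < p := by
    have h1 := Lagrange.degree_interpolate_lt (s := Finset.univ) (v := id) π (Set.injOn_id _)
    rw [Finset.card_univ, ZMod.card] at h1
    by_cases h : f = 0
    · rw [h]; simpa using hp.pos
    · exact (natDegree_lt_iff_degree_lt h).2 h1
  have hshift : ∀ (g : ZMod p → ZMod p) x, ∑ u ∈ U, g (π (x + u)) = ∑ u ∈ U, g (π x + u) := by
    intro g x
    refine Finset.sum_nbij' (fun u => π (x + u) - π x) (fun u => π.symm (π x + u) - x)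
      ?_ ?_ ?_ ?_ ?_
    · intro u hu
      rw [← hπ]; simpa using hu
    · intro u hu
      rw [hπ]; simpa using hu
    · simp
    · simp
    · simp
  have hpow : ∀ j, j < r → ∀ x : ZMod p, ∑ u ∈ U, (x + u) ^ j = ∑ _u ∈ U, x ^ j := by
    intro j hj x
    simp only [add_pow]
    rw [Finset.sum_comm, Finset.sum_eq_single_of_mem j (by simp)]
    · simp
    · intro i hi hij
      have : i < j + 1 := by simpa using hi
      rw [Finset.sum_congr rfl fun u _ => show x ^ i * u ^ (j - i) * (j.choose i : ZMod p) =
        x ^ i * (j.choose i : ZMod p) * u ^ (j - i) by ring, ← Finset.mul_sum,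
        hw _ (by omega) (by omega), mul_zero]
  have key : ∀ j, j < r → j * f.natDegree < p → j * f.natDegree < r := by
    intro j hj hjp
    rw [← natDegree_pow] at hjp ⊢
    refine natDegree_lt_of_sum_shift_eq U r hr0 hw hwr _ hjp fun x => ?_
    simp only [eval_pow, hfe]
    rw [hshift (fun y => y ^ j), hpow j hj]
  have hn1 : f.natDegree ≤ 1 := by
    by_contra! hn
    have h1 := key 1 (by omega) (by omega)
    set n := f.natDegree
    have hm := Nat.div_add_mod r n
    have hm2 := Nat.mod_lt r (show 0 < n by omega)
    have hm3 : r / n ≤ r / 2 := Nat.div_le_div_left hn (by omega)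
    have h2 := key (r / n + 1) (by omega) (by rw [add_mul, mul_comm (r / n)]; omega)
    rw [add_mul, mul_comm (r / n)] at h2
    omega
  refine ⟨f.coeff 1, f.coeff 0, fun x => ?_⟩
  rw [← hfe, eval_eq_sum_range' (Nat.lt_succ_of_le hn1)]
  simp [Finset.sum_range_succ, add_comm]

/-- Burnside's theorem on permutation groups of prime degree, in the form of Müller: a permutation
of the integers modulo `p` preserving the differences in a proper nonempty symmetric set of
nonzero residues is affine. -/
theorem exists_affine {p : ℕ} [Fact p.Prime] (hp2 : p ≠ 2) (U : Finset (ZMod p))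
    (h0 : (0 : ZMod p) ∉ U) (hne : U.Nonempty) (hneg : ∀ u ∈ U, -u ∈ U)
    (hcard : U.card < p - 1) (π : Equiv.Perm (ZMod p))
    (hπ : ∀ x y, x - y ∈ U ↔ π x - π y ∈ U) : ∃ a b, ∀ x, π x = a * x + b := by
  classical
  by_cases h : 2 * U.card ≤ p - 1
  · exact exists_affine_of_card_le hp2 U h0 hne hneg h π hπ
  have hc : (Finset.univ \ insert 0 U).card = p - 1 - U.card := by
    rw [Finset.card_sdiff_of_subset (Finset.subset_univ _), Finset.card_insert_of_notMem h0,
      Finset.card_univ, ZMod.card]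
    omega
  refine exists_affine_of_card_le hp2 (Finset.univ \ insert 0 U) (by simp) ?_ ?_ (by omega) π ?_
  · rw [← Finset.card_pos]; omega
  · intro u hu
    simp only [Finset.mem_sdiff, Finset.mem_univ, Finset.mem_insert, true_and, not_or,
      neg_eq_zero] at hu ⊢
    exact ⟨hu.1, fun h => hu.2 (by simpa using hneg _ h)⟩
  · intro x y
    simp [sub_eq_zero, hπ x y]

/-- A vertex transitive graph on a prime number of vertices is circulant. -/
theorem exists_equiv_zmod {p : ℕ} [Fact p.Prime] {X : Type*} (hX : Nat.card X = p)
    (Δ : SimpleGraph X) (ht : ∀ x y, ∃ φ : Δ ≃g Δ, φ x = y) :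
    ∃ e : ZMod p ≃ X, ∀ t x y, Δ.Adj (e (x + t)) (e (y + t)) ↔ Δ.Adj (e x) (e y) := by
  classical
  have hp := (Fact.out : p.Prime)
  have : Finite X := Nat.finite_of_card_ne_zero (by rw [hX]; exact hp.ne_zero)
  have := Fintype.ofFinite X
  have : Nonempty X := by rw [← Finite.card_pos_iff, hX]; exact hp.pos
  let G : Subgroup (Equiv.Perm X) :=
    { carrier := {g | ∀ x y, Δ.Adj (g x) (g y) ↔ Δ.Adj x y}
      mul_mem' := by
        intro a b ha hb x y
        rw [Equiv.Perm.mul_apply, Equiv.Perm.mul_apply, ha, hb]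
      one_mem' := by simp
      inv_mem' := by
        intro a ha x y
        rw [← ha (a⁻¹ x)]; simp }
  have hG : MulAction.IsPretransitive G X := ⟨fun x y => by
    obtain ⟨φ, hφ⟩ := ht x y
    exact ⟨⟨φ.toEquiv, fun a b => φ.map_adj_iff⟩, hφ⟩⟩
  have hdvd : p ∣ Nat.card G := by
    obtain ⟨x⟩ := ‹Nonempty X›
    have := MulAction.index_stabilizer_of_transitive G x
    rw [hX] at this
    rw [← this]
    exact Subgroup.index_dvd_card _
  obtain ⟨g, hg⟩ := exists_prime_orderOf_dvd_card' p hdvd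
  have hcard : Fintype.card X = p := by rw [← Nat.card_eq_fintype_card, hX]
  have hcyc : (g : Equiv.Perm X).IsCycle := Equiv.Perm.isCycle_of_prime_order''
    (by rw [hcard]; exact hp) (by rw [hcard, Subgroup.orderOf_coe, hg])
  have hord : orderOf (g : Equiv.Perm X) = p := by rw [Subgroup.orderOf_coe, hg]
  have hmod : ∀ n, (g : Equiv.Perm X) ^ (n % p) = (g : Equiv.Perm X) ^ n := fun n => by
    rw [← pow_mod_orderOf (g : Equiv.Perm X) n, hord]
  have hsupp : (g : Equiv.Perm X).support = Finset.univ :=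
    Finset.eq_univ_of_card _ (hcyc.orderOf.symm.trans (hord.trans hcard.symm))
  have hmove : ∀ x, (g : Equiv.Perm X) x ≠ x := fun x => by
    rw [← Equiv.Perm.mem_support, hsupp]; exact Finset.mem_univ x
  obtain ⟨x₀⟩ := ‹Nonempty X›
  let f : ZMod p → X := fun i => ((g : Equiv.Perm X) ^ i.val) x₀
  have hf : ∀ x t, f (x + t) = ((g ^ t.val : G) : Equiv.Perm X) (f x) := by
    intro x t
    have h1 : (g : Equiv.Perm X) ^ (x + t).val = (g : Equiv.Perm X) ^ (t.val + x.val) := by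
      rw [ZMod.val_add, add_comm t.val, hmod]
    simp only [f]
    rw [h1, pow_add, Equiv.Perm.mul_apply, Subgroup.coe_pow]
  have hsurj : Function.Surjective f := by
    intro y
    obtain ⟨n, hn⟩ := hcyc.exists_pow_eq (hmove x₀) (hmove y)
    refine ⟨n, ?_⟩
    simp only [f]
    rw [ZMod.val_natCast, hmod, hn]
  have hbij : Function.Bijective f := by
    rw [Fintype.bijective_iff_surjective_and_card]
    exact ⟨hsurj, by rw [hcard, ZMod.card]⟩
  refine ⟨Equiv.ofBijective f hbij, fun t x y => ?_⟩
  simp only [Equiv.ofBijective_apply, hf]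
  exact (g ^ t.val).2 _ _

/-- A nonempty set of residues modulo a prime that is stable under a nontrivial translation
contains everything. -/
theorem mem_of_add_mem {p : ℕ} [Fact p.Prime] {W : Set (ZMod p)} {d : ZMod p} (hd : d ≠ 0)
    (hadd : ∀ t ∈ W, t + d ∈ W) {a : ZMod p} (ha : a ∈ W) (t : ZMod p) : t ∈ W := by
  have h : ∀ n : ℕ, a + n * d ∈ W := by
    intro n
    induction n with
    | zero => simpa using ha
    | succ n ih =>
      have := hadd _ ih
      rwa [show a + n * d + d = a + (n + 1 : ℕ) * d by push_cast; ring] at this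
  have h1 := h ((t - a) / d).val
  rw [ZMod.natCast_zmod_val, div_mul_cancel₀ _ hd] at h1
  simpa using h1

/-- A vertex transitive graph of prime order that is not complete has no adjacent twins. -/
theorem exists_adj_not_adj {p : ℕ} [Fact p.Prime] {X : Type*} (hX : Nat.card X = p)
    {Δ : SimpleGraph X} (ht : ∀ x y, ∃ φ : Δ ≃g Δ, φ x = y) (htop : Δ ≠ ⊤) {x y : X}
    (hxy : Δ.Adj x y) : ∃ z, z ≠ y ∧ Δ.Adj x z ∧ ¬ Δ.Adj y z := by
  by_contra! hcon
  obtain ⟨e, he⟩ := exists_equiv_zmod hX Δ ht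
  obtain ⟨a, rfl⟩ := e.surjective x
  obtain ⟨b, rfl⟩ := e.surjective y
  have hall := mem_of_add_mem (W := {t | t = 0 ∨ Δ.Adj (e 0) (e t)}) (d := a - b) (a := 0)
    (sub_ne_zero.2 fun h => hxy.ne (by rw [h])) ?_ (Or.inl rfl)
  · apply htop
    ext x y
    obtain ⟨x, rfl⟩ := e.surjective x
    obtain ⟨y, rfl⟩ := e.surjective y
    rw [top_adj]
    refine ⟨fun h => h.ne, fun h => ?_⟩
    rcases hall (y - x) with h1 | h1
    · exact absurd (by rw [sub_eq_zero.1 h1]) h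
    · rw [← he x] at h1
      simpa using h1
  · rintro t (rfl | h)
    · right
      rw [← he b]
      simpa using hxy.symm
    · rw [← he a] at h
      by_cases htb : t + a = b
      · left
        linear_combination htb
      · right
        have := hcon (e (t + a)) (by simpa using htb) (by simpa using h)
        rw [← he b]
        simpa [add_sub_assoc, add_assoc] using this

/-- A nonempty vertex transitive graph of prime order is connected. -/
theorem mem_of_adj_mem {p : ℕ} [Fact p.Prime] {X : Type*} (hX : Nat.card X = p)
    {Δ : SimpleGraph X} (ht : ∀ x y, ∃ φ : Δ ≃g Δ, φ x = y) (hbot : Δ ≠ ⊥) {W : Set X}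
    (hW : ∀ x ∈ W, ∀ y, Δ.Adj x y → y ∈ W) {x : X} (hx : x ∈ W) (y : X) : y ∈ W := by
  obtain ⟨e, he⟩ := exists_equiv_zmod hX Δ ht
  obtain ⟨a, b, hab⟩ := ne_bot_iff_exists_adj.1 hbot
  obtain ⟨a, rfl⟩ := e.surjective a
  obtain ⟨b, rfl⟩ := e.surjective b
  obtain ⟨x, rfl⟩ := e.surjective x
  obtain ⟨y, rfl⟩ := e.surjective y
  refine mem_of_add_mem (W := e ⁻¹' W) (d := b - a)
    (sub_ne_zero.2 fun h => hab.ne (by rw [h])) (fun t h => hW _ h _ ?_) hx y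
  rw [← he (t - a)] at hab
  convert hab using 2 <;> ring_nf

/-- A set of nonzero residues modulo `p` that is an orbit of its own multiplicative stabilizer has
size dividing `p - 1`. -/
theorem card_dvd_of_stabilizer_transitive {p : ℕ} [Fact p.Prime] {U : Finset (ZMod p)}
    (h0 : (0 : ZMod p) ∉ U) (hne : U.Nonempty)
    (hmul : ∀ u ∈ U, ∀ u' ∈ U, ∃ a, a * u = u' ∧ ∀ t, t ∈ U ↔ a * t ∈ U) : U.card ∣ p - 1 := by
  let H : Subgroup (ZMod p)ˣ :=
    { carrier := {a | ∀ t, t ∈ U ↔ (a : ZMod p) * t ∈ U}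
      mul_mem' := by
        intro a b ha hb t
        rw [hb, ha, Units.val_mul, mul_assoc]
      one_mem' := by simp
      inv_mem' := by
        intro a ha t
        rw [ha (((a⁻¹ : (ZMod p)ˣ) : ZMod p) * t), Units.mul_inv_cancel_left] }
  obtain ⟨u, hu⟩ := hne
  have hu0 : u ≠ 0 := fun h => h0 (h ▸ hu)
  let f : H → U := fun a => ⟨(a : (ZMod p)ˣ) * u, (a.2 u).1 hu⟩
  have hf : Function.Bijective f := by
    constructor
    · intro a b hab
      have h1 := congrArg Subtype.val hab
      exact Subtype.ext (Units.ext (mul_right_cancel₀ hu0 h1))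
    · rintro ⟨u', hu'⟩
      obtain ⟨a, ha, hat⟩ := hmul u hu u' hu'
      have ha0 : a ≠ 0 := by
        rintro rfl
        exact h0 (by rwa [← ha, zero_mul] at hu')
      exact ⟨⟨Units.mk0 a ha0, hat⟩, Subtype.ext ha⟩
  have h1 := Subgroup.card_subgroup_dvd_card H
  rw [Nat.card_eq_of_bijective f hf, Nat.card_eq_fintype_card, Fintype.card_coe,
    Nat.card_eq_fintype_card, ZMod.card_units] at h1
  exact h1

theorem le_card_compl_inter_shift {p : ℕ} [Fact p.Prime] {U : Finset (ZMod p)}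
    (hneg : ∀ u ∈ U, -u ∈ U) {u : ZMod p} (hu : u ∈ U) :
    p ≤ (Finset.univ.filter fun t => (t ≠ 0 ∧ t ∉ U) ∧ (t ≠ u ∧ t - u ∉ U)).card
      + 2 * U.card := by
  classical
  have h1 : (Finset.univ : Finset (ZMod p)) ⊆
      (Finset.univ.filter fun t => (t ≠ 0 ∧ t ∉ U) ∧ (t ≠ u ∧ t - u ∉ U)) ∪
        (U ∪ U.image fun t => t + u) := by
    intro t _
    simp only [Finset.mem_union, Finset.mem_filter, Finset.mem_univ, true_and, Finset.mem_image]
    by_cases ht : t ∈ U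
    · exact Or.inr (Or.inl ht)
    by_cases ht' : t - u ∈ U
    · exact Or.inr (Or.inr ⟨_, ht', by ring⟩)
    refine Or.inl ⟨⟨?_, ht⟩, ?_, ht'⟩
    · rintro rfl
      exact ht' (by simpa using hneg u hu)
    · rintro rfl
      exact ht hu
  have h2 := (Finset.card_le_card h1).trans (Finset.card_union_le _ _)
  have h3 := Finset.card_union_le U (U.image fun t => t + u)
  have h4 := Finset.card_image_le (s := U) (f := fun t => t + u)
  rw [Finset.card_univ, ZMod.card] at h2
  omega

/-- The common non-neighbours of two adjacent vertices in a graph of Paley type. -/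
theorem card_compl_inter_shift {p : ℕ} [Fact p.Prime] {U : Finset (ZMod p)}
    (h0 : (0 : ZMod p) ∉ U) (hneg : ∀ u ∈ U, -u ∈ U)
    (hmul : ∀ u ∈ U, ∀ u' ∈ U, ∃ a, a * u = u' ∧ ∀ t, t ∈ U ↔ a * t ∈ U)
    (hcard : 2 * U.card + 1 = p) {u : ZMod p} (hu : u ∈ U) :
    U.card = 2 * (Finset.univ.filter fun t => (t ≠ 0 ∧ t ∉ U) ∧ (t ≠ u ∧ t - u ∉ U)).card := by
  classical
  have hu0 : u ≠ 0 := fun h => h0 (h ▸ hu)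
  set U' : Finset (ZMod p) := Finset.univ.filter fun t => t ≠ 0 ∧ t ∉ U with hU'
  have hmem : ∀ t, t ∈ U' ↔ t ≠ 0 ∧ t ∉ U := by simp [hU']
  have hcU' : U'.card = U.card := by
    have h1 : U' = Finset.univ \ insert 0 U := by ext t; simp [hU', not_or]
    rw [h1, Finset.card_sdiff_of_subset (Finset.subset_univ _), Finset.card_insert_of_notMem h0,
      Finset.card_univ, ZMod.card]
    omega
  have hswap : ∀ s ∈ U', ∀ x ∈ U, x * u / s ∈ U' := by
    intro s hs x hx
    rw [hmem] at hs ⊢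
    have hx0 : x ≠ 0 := fun h => h0 (h ▸ hx)
    refine ⟨div_ne_zero (mul_ne_zero hx0 hu0) hs.1, fun h => hs.2 ?_⟩
    obtain ⟨a, ha, hat⟩ := hmul x hx _ h
    have ha' : a = u / s := by
      rw [mul_comm, mul_div_assoc] at ha
      exact mul_left_cancel₀ hx0 ha
    rw [hat, ha', div_mul_cancel₀ _ hs.1]
    exact hu
  have hswap' : ∀ s ∈ U', ∀ x ∈ U', x * u / s ∈ U := by
    intro s hs x hx
    have hs0 := ((hmem s).1 hs).1
    have hinj : Function.Injective fun x : ZMod p => x * u / s := by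
      intro x y hxy
      simp only at hxy
      field_simp at hxy
      exact hxy
    have himg : U.image (fun x => x * u / s) = U' := by
      apply Finset.eq_of_subset_of_card_le
      · intro y hy
        obtain ⟨x, hx, rfl⟩ := Finset.mem_image.1 hy
        exact hswap s hs x hx
      · rw [Finset.card_image_of_injective _ hinj, hcU']
    by_contra hcon
    have h1 : x * u / s ∈ U' :=
      (hmem _).2 ⟨div_ne_zero (mul_ne_zero ((hmem x).1 hx).1 hu0) hs0, hcon⟩
    rw [← himg] at h1
    obtain ⟨y, hy, hyx⟩ := Finset.mem_image.1 h1
    exact ((hmem x).1 hx).2 (hinj hyx ▸ hy)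
  have hB : (Finset.univ.filter fun t => (t ≠ 0 ∧ t ∉ U) ∧ (t ≠ u ∧ t - u ∉ U)) =
      Finset.univ.filter fun t => t ∈ U' ∧ t - u ∈ U' := by
    ext t
    simp [hmem, sub_eq_zero]
  have hAB : (Finset.univ.filter fun t => t ∈ U ∧ t - u ∈ U').card =
      (Finset.univ.filter fun t => t ∈ U' ∧ t - u ∈ U').card := by
    have hinv : ∀ t, t - u ∈ U' → t * u / (t - u) * u / (t * u / (t - u) - u) = t := by
      intro t ht
      have h1 := ((hmem _).1 ht).1
      rw [show t * u / (t - u) - u = u * u / (t - u) by field_simp; ring]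
      field_simp
    have hsub : ∀ t, t - u ∈ U' → t * u / (t - u) - u ∈ U' := by
      intro t ht
      have h1 := ((hmem _).1 ht).1
      rw [show t * u / (t - u) - u = u * u / (t - u) by field_simp; ring]
      exact hswap _ ht u hu
    refine Finset.card_nbij' (fun t => t * u / (t - u)) (fun t => t * u / (t - u)) ?_ ?_ ?_ ?_
    · intro t ht
      simp only [Finset.coe_filter, Finset.mem_univ, true_and, Set.mem_ofPred_eq] at ht ⊢
      exact ⟨hswap _ ht.2 t ht.1, hsub t ht.2⟩
    · intro t ht
      simp only [Finset.coe_filter, Finset.mem_univ, true_and, Set.mem_ofPred_eq] at ht ⊢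
      exact ⟨hswap' _ ht.2 t ht.1, hsub t ht.2⟩
    · intro t ht
      simp only [Finset.coe_filter, Finset.mem_univ, true_and, Set.mem_ofPred_eq] at ht
      exact hinv t ht.2
    · intro t ht
      simp only [Finset.coe_filter, Finset.mem_univ, true_and, Set.mem_ofPred_eq] at ht
      exact hinv t ht.2
  have hsum : (Finset.univ.filter fun t => t ∈ U ∧ t - u ∈ U').card +
      (Finset.univ.filter fun t => t ∈ U' ∧ t - u ∈ U').card = U'.card := by
    rw [← Finset.card_union_of_disjoint]
    · refine Finset.card_nbij' (fun t => t - u) (fun t => t + u) ?_ ?_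
        (fun t _ => sub_add_cancel t u) (fun t _ => add_sub_cancel_right t u)
      · intro t ht
        simp only [Finset.coe_union, Finset.coe_filter, Finset.mem_univ, true_and, Set.mem_union,
          Set.mem_ofPred_eq] at ht
        exact ht.elim And.right And.right
      · intro t ht
        have ht' : t ∈ U' := ht
        simp only [Finset.coe_union, Finset.coe_filter, Finset.mem_univ, true_and, Set.mem_union,
          Set.mem_ofPred_eq, add_sub_cancel_right, ht', and_true, hmem (t + u)]
        by_cases h : t + u ∈ U
        · exact Or.inl h
        · refine Or.inr ⟨fun h1 => ((hmem t).1 ht').2 ?_, h⟩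
          rw [eq_neg_of_add_eq_zero_left h1]
          exact hneg u hu
    · rw [Finset.disjoint_left]
      intro t ht ht'
      simp only [Finset.mem_filter, Finset.mem_univ, true_and, hmem t] at ht ht'
      exact ht'.1.2 ht.1
  rw [hB]
  omega

open Classical in
/-- The parameters of an arc transitive graph of prime order. -/
theorem ArcTransitive.exists_valency {p : ℕ} [Fact p.Prime] {X : Type*} [Fintype X]
    (hX : Nat.card X = p) {Δ : SimpleGraph X} (ht : ∀ x y, ∃ φ : Δ ≃g Δ, φ x = y)
    (harc : ArcTransitive Δ) (hbot : Δ ≠ ⊥) (htop : Δ ≠ ⊤) :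
    ∃ k, 0 < k ∧ k < p - 1 ∧ k ∣ p - 1 ∧ (∀ x, (Finset.univ.filter fun y => Δ.Adj x y).card = k) ∧
      ∀ x y, Δ.Adj x y →
        p ≤ (Finset.univ.filter fun z => Δᶜ.Adj x z ∧ Δᶜ.Adj y z).card + 2 * k ∧
        (2 * k + 1 = p → k = 2 * (Finset.univ.filter fun z => Δᶜ.Adj x z ∧ Δᶜ.Adj y z).card) := by
  obtain ⟨e, he⟩ := exists_equiv_zmod hX Δ ht
  set U : Finset (ZMod p) := Finset.univ.filter fun t => Δ.Adj (e 0) (e t) with hU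
  have hadj : ∀ a b, Δ.Adj (e a) (e b) ↔ b - a ∈ U := by
    intro a b
    rw [← he (-a)]
    simp [hU, sub_eq_add_neg]
  have h0 : (0 : ZMod p) ∉ U := by simp [hU]
  have hneg : ∀ u ∈ U, -u ∈ U := by
    intro u hu
    have h1 : Δ.Adj (e 0) (e u) := by rw [hadj]; simpa using hu
    rw [adj_comm, hadj] at h1
    simpa using h1
  have hne : U.Nonempty := by
    obtain ⟨a, b, hab⟩ := ne_bot_iff_exists_adj.1 hbot
    obtain ⟨a, rfl⟩ := e.surjective a
    obtain ⟨b, rfl⟩ := e.surjective b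
    exact ⟨_, (hadj a b).1 hab⟩
  have hlt : U.card < p - 1 := by
    by_contra! hcard
    have h1 : U = Finset.univ.erase 0 := by
      apply Finset.eq_of_subset_of_card_le
      · intro t ht
        exact Finset.mem_erase.2 ⟨fun h => h0 (h ▸ ht), Finset.mem_univ _⟩
      · rw [Finset.card_erase_of_mem (Finset.mem_univ _), Finset.card_univ, ZMod.card]
        exact hcard
    apply htop
    ext x y
    obtain ⟨a, rfl⟩ := e.surjective x
    obtain ⟨b, rfl⟩ := e.surjective y
    simp [hadj, h1, sub_eq_zero, eq_comm]
  have hpos := hne.card_pos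
  have hmul : ∀ u ∈ U, ∀ u' ∈ U, ∃ a, a * u = u' ∧ ∀ t, t ∈ U ↔ a * t ∈ U := by
    intro u hu u' hu'
    obtain ⟨φ, hφ0, hφu⟩ := harc (v := e 0) (u := e u) (v' := e 0) (u' := e u')
      (by simpa [hadj] using hu) (by simpa [hadj] using hu')
    set π : Equiv.Perm (ZMod p) := (e.trans φ.toEquiv).trans e.symm with hπ
    have heπ : ∀ x, e (π x) = φ (e x) := fun x => by simp [hπ]
    have hdiff : ∀ x y, x - y ∈ U ↔ π x - π y ∈ U := by
      intro x y
      rw [← hadj, ← hadj, heπ, heπ, φ.map_adj_iff]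
    obtain ⟨a, b, hab⟩ := exists_affine (by omega) U h0 hne hneg hlt π hdiff
    have hπ0 : π 0 = 0 := e.injective (by rw [heπ, hφ0])
    have hb : b = 0 := by simpa [hπ0] using (hab 0).symm
    have hπu : π u = u' := e.injective (by rw [heπ, hφu])
    refine ⟨a, ?_, fun t => ?_⟩
    · rw [← hπu, hab, hb, add_zero]
    · have := hdiff t 0
      rwa [hπ0, sub_zero, sub_zero, hab, hb, add_zero] at this
  refine ⟨U.card, hpos, hlt, card_dvd_of_stabilizer_transitive h0 hne hmul, ?_, ?_⟩
  · intro x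
    obtain ⟨a, rfl⟩ := e.surjective x
    refine Finset.card_nbij' (fun y => e.symm y - a) (fun t => e (t + a)) ?_ ?_ ?_ ?_
    · intro y hy
      obtain ⟨b, rfl⟩ := e.surjective y
      simpa [hadj] using hy
    · intro t ht
      have ht' : t ∈ U := ht
      simpa [hadj] using ht'
    · intro y _
      simp
    · intro t _
      simp
  · intro x y hxy
    obtain ⟨a, rfl⟩ := e.surjective x
    obtain ⟨b, rfl⟩ := e.surjective y
    rw [hadj] at hxy
    have hM : (Finset.univ.filter fun z => Δᶜ.Adj (e a) z ∧ Δᶜ.Adj (e b) z).card =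
        (Finset.univ.filter fun t =>
          (t ≠ 0 ∧ t ∉ U) ∧ (t ≠ b - a ∧ t - (b - a) ∉ U)).card := by
      have h1 : ∀ t, t ∈ (Finset.univ.filter fun t =>
          (t ≠ 0 ∧ t ∉ U) ∧ (t ≠ b - a ∧ t - (b - a) ∉ U)) ↔
          Δᶜ.Adj (e a) (e (t + a)) ∧ Δᶜ.Adj (e b) (e (t + a)) := by
        intro t
        simp only [Finset.mem_filter, Finset.mem_univ, true_and, compl_adj, hadj, ne_eq,
          e.injective.eq_iff, add_sub_cancel_right]
        rw [show t + a - b = t - (b - a) by ring, eq_sub_iff_add_eq, eq_comm (a := b)]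
        simp [eq_comm]
      refine Finset.card_nbij' (fun y => e.symm y - a) (fun t => e (t + a)) ?_ ?_ ?_ ?_
      · intro y hy
        refine (h1 _).2 ?_
        simpa using hy
      · intro t ht
        simpa using (h1 t).1 ht
      · intro y _
        simp
      · intro t _
        simp
    rw [hM]
    exact ⟨le_card_compl_inter_shift hneg hxy,
      fun h => card_compl_inter_shift h0 hneg hmul h hxy⟩

theorem SimpleGraph.Connected.dist_eq_two_iff {V : Type*} {Γ : SimpleGraph V} (hconn : Γ.Connected)
    {v w : V} : Γ.dist v w = 2 ↔ w ≠ v ∧ ¬ Γ.Adj v w ∧ ∃ u, Γ.Adj v u ∧ Γ.Adj u w := by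
  constructor
  · intro h
    refine ⟨?_, ?_, ?_⟩
    · rintro rfl
      simp at h
    · intro h1
      rw [← dist_eq_one_iff_adj] at h1
      omega
    · obtain ⟨q, hq⟩ := hconn.exists_walk_length_eq_dist v w
      rw [h] at hq
      match q, hq with
      | .cons h1 (.cons h2 .nil), _ => exact ⟨_, h1, h2⟩
  · rintro ⟨hne, hadj, u, h1, h2⟩
    have h3 := dist_le (Walk.cons h1 (Walk.cons h2 Walk.nil))
    have h4 := hconn.one_lt_dist_of_ne_of_not_adj hne.symm hadj
    simp only [Walk.length_cons, Walk.length_nil] at h3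
    omega

theorem SimpleGraph.Connected.exists_of_dist_eq_three {V : Type*} {Γ : SimpleGraph V}
    (hconn : Γ.Connected) {v z : V} (h : Γ.dist v z = 3) :
    ¬ Γ.Adj v z ∧ (∀ u, Γ.Adj v u → ¬ Γ.Adj u z) ∧
      ∃ u w, Γ.Adj v u ∧ Γ.Adj u w ∧ Γ.Adj w z := by
  refine ⟨?_, ?_, ?_⟩
  · intro h1
    rw [← dist_eq_one_iff_adj] at h1
    omega
  · intro u h1 h2
    have h3 := dist_le (Walk.cons h1 (Walk.cons h2 Walk.nil))
    simp only [Walk.length_cons, Walk.length_nil] at h3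
    omega
  · obtain ⟨q, hq⟩ := hconn.exists_walk_length_eq_dist v z
    rw [h] at hq
    match q, hq with
    | .cons h1 (.cons h2 (.cons h3 .nil)), _ => exact ⟨_, _, h1, h2, h3⟩

open Classical in
/-- Counting the edges between the first two spheres around a vertex. -/
theorem mul_eq_card_dist_two_mul {V : Type*} [Fintype V] {Γ : SimpleGraph V} {p k c : ℕ}
    (hreg : ∀ v, (Finset.univ.filter fun y => Γ.Adj v y).card = p) (hconn : Γ.Connected)
    (hk : ∀ u x, Γ.Adj u x →
      (Finset.univ.filter fun y => Γ.Adj u y ∧ y ≠ x ∧ ¬ Γ.Adj x y).card = k)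
    (hc : ∀ v w, Γ.dist v w = 2 →
      (Finset.univ.filter fun y => Γ.Adj v y ∧ Γ.Adj y w).card = c) (v : V) :
    p * k = (Finset.univ.filter fun w => Γ.dist v w = 2).card * c := by
  have h := Finset.sum_card_bipartiteAbove_eq_sum_card_bipartiteBelow
    (s := Finset.univ.filter fun y => Γ.Adj v y)
    (t := Finset.univ.filter fun w => Γ.dist v w = 2) (r := Γ.Adj)
  rw [Finset.sum_congr rfl (g := fun _ => k), Finset.sum_const, hreg,
    Finset.sum_congr (s₁ := Finset.univ.filter fun w => Γ.dist v w = 2) rfl (g := fun _ => c),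
    Finset.sum_const] at h
  · simpa using h
  · intro w hw
    rw [← hc v w (by simpa using hw), Finset.bipartiteBelow, Finset.filter_filter]
  · intro u hu
    have hvu : Γ.Adj v u := by simpa using hu
    rw [← hk u v hvu.symm, Finset.bipartiteAbove, Finset.filter_filter]
    congr 1
    ext y
    simp only [Finset.mem_filter, Finset.mem_univ, true_and, hconn.dist_eq_two_iff]
    exact ⟨fun h => ⟨h.2, h.1.1, h.1.2.1⟩, fun h => ⟨⟨h.2.1, h.2.2, u, hvu, h.1⟩, h.1⟩⟩

open Classical in
/-- In a graph where each edge `{v, u}` leaves as many neighbours of `u` at distance two from `v`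
as there are paths joining two vertices at distance two, and whose local graphs are connected and
without twins, each vertex at distance three from `v` is joined to all vertices at distance two
from `v`. -/
theorem adj_iff_dist_eq_two {V : Type*} [Fintype V] {Γ : SimpleGraph V} {p k : ℕ}
    (hreg : ∀ v, (Finset.univ.filter fun y => Γ.Adj v y).card = p) (hconn : Γ.Connected)
    (hk0 : 0 < k)
    (hk : ∀ u x, Γ.Adj u x →
      (Finset.univ.filter fun y => Γ.Adj u y ∧ y ≠ x ∧ ¬ Γ.Adj x y).card = k)
    (hc : ∀ v w, Γ.dist v w = 2 →
      (Finset.univ.filter fun y => Γ.Adj v y ∧ Γ.Adj y w).card = k)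
    (htwin : ∀ u x y, Γ.Adj u x → Γ.Adj u y → Γ.Adj x y →
      ∃ z, Γ.Adj u z ∧ z ≠ y ∧ Γ.Adj x z ∧ ¬ Γ.Adj y z)
    (hloc : ∀ (u : V) (W : Set V),
      (∀ x ∈ W, Γ.Adj u x → ∀ y, Γ.Adj u y → Γ.Adj x y → y ∈ W) →
      ∀ x ∈ W, Γ.Adj u x → ∀ y, Γ.Adj u y → y ∈ W) {v z : V} (hz : Γ.dist v z = 3) (y : V) :
    Γ.Adj z y ↔ Γ.dist v y = 2 := by
  obtain ⟨hvz, hcom, u, w, hvu, huw, hwz⟩ := hconn.exists_of_dist_eq_three hz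
  have hclaim : ∀ u, Γ.Adj v u → (∃ w, Γ.Adj u w ∧ Γ.Adj w z) →
      ∀ w, Γ.Adj u w → w ≠ v → ¬ Γ.Adj v w → Γ.Adj w z := by
    rintro u hvu ⟨w, huw, hwz⟩ w' huw' hne hadj
    have h2 : Γ.dist u z = 2 := by
      rw [hconn.dist_eq_two_iff]
      refine ⟨?_, hcom u hvu, w, huw, hwz⟩
      rintro rfl
      exact hvz hvu
    have heq : (Finset.univ.filter fun y => Γ.Adj u y ∧ Γ.Adj y z) =
        Finset.univ.filter fun y => Γ.Adj u y ∧ y ≠ v ∧ ¬ Γ.Adj v y := by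
      apply Finset.eq_of_subset_of_card_le
      · intro y hy
        simp only [Finset.mem_filter, Finset.mem_univ, true_and] at hy ⊢
        refine ⟨hy.1, ?_, fun h => hcom y h hy.2⟩
        rintro rfl
        exact hvz hy.2
      · rw [hc u z h2, hk u v hvu.symm]
    have hw' : w' ∈ Finset.univ.filter fun y => Γ.Adj u y ∧ y ≠ v ∧ ¬ Γ.Adj v y := by
      simp [huw', hne, hadj]
    rw [← heq] at hw'
    simp only [Finset.mem_filter, Finset.mem_univ, true_and] at hw'
    exact hw'.2
  have hall : ∀ u, Γ.Adj v u → ∃ w, Γ.Adj u w ∧ Γ.Adj w z := by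
    refine hloc v {u | ∃ w, Γ.Adj u w ∧ Γ.Adj w z} ?_ u ⟨w, huw, hwz⟩ hvu
    rintro a ha hva b hvb hab
    obtain ⟨t, hat, htv, hbt, hvt⟩ := htwin a b v hab hva.symm hvb.symm
    exact ⟨t, hbt, hclaim a hva ha t hat htv hvt⟩
  have hcard : (Finset.univ.filter fun w => Γ.dist v w = 2).card = p :=
    (Nat.eq_of_mul_eq_mul_right hk0 (mul_eq_card_dist_two_mul hreg hconn hk hc v)).symm
  have heq : (Finset.univ.filter fun w => Γ.dist v w = 2) =
      Finset.univ.filter fun y => Γ.Adj z y := by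
    apply Finset.eq_of_subset_of_card_le
    · intro w hw
      simp only [Finset.mem_filter, Finset.mem_univ, true_and, hconn.dist_eq_two_iff] at hw ⊢
      obtain ⟨hne, hadj, u, hvu, huw⟩ := hw
      exact (hclaim u hvu (hall u hvu) w huw hne hadj).symm
    · rw [hcard, hreg]
  have := congrArg (y ∈ ·) heq
  simp only [Finset.mem_filter, Finset.mem_univ, true_and, eq_iff_iff] at this
  exact this.symm

open Classical in
theorem existsUnique_dist_eq_three_and_diam {V : Type*} [Fintype V] {Γ : SimpleGraph V} {p k : ℕ}
    (hp : Odd p) (hreg : ∀ v, (Finset.univ.filter fun y => Γ.Adj v y).card = p)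
    (hconn : Γ.Connected) (hk0 : 0 < k) (hkp : k < p)
    (hk : ∀ u x, Γ.Adj u x →
      (Finset.univ.filter fun y => Γ.Adj u y ∧ y ≠ x ∧ ¬ Γ.Adj x y).card = k)
    (hc : ∀ v w, Γ.dist v w = 2 →
      (Finset.univ.filter fun y => Γ.Adj v y ∧ Γ.Adj y w).card = k)
    (hadj : ∀ v z, Γ.dist v z = 3 → ∀ y, Γ.Adj z y ↔ Γ.dist v y = 2) :
    (∀ v : V, ∃! v' : V, Γ.dist v v' = 3) ∧ Γ.diam = 3 := by
  have hcard (v : V) : (Finset.univ.filter fun w => Γ.dist v w = 2).card = p :=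
    (Nat.eq_of_mul_eq_mul_right hk0 (mul_eq_card_dist_two_mul hreg hconn hk hc v)).symm
  have hle : ∀ v x, Γ.dist v x ≤ 3 := by
    intro v x
    have hr := hconn v x
    rw [reachable_iff_reflTransGen] at hr
    induction hr with
    | refl => simp
    | @tail x y _ hxy ih =>
      by_cases h3 : Γ.dist v x = 3
      · have := (hadj v x h3 y).1 hxy
        omega
      · have h1 := hconn.dist_triangle (u := v) (v := x) (w := y)
        rw [dist_eq_one_iff_adj.2 hxy] at h1
        omega
  have hex : ∀ v, ∃ z, Γ.dist v z = 3 := by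
    intro v
    by_contra! hno
    have hU : (Finset.univ : Finset V) = insert v ((Finset.univ.filter fun y => Γ.Adj v y) ∪
        Finset.univ.filter fun w => Γ.dist v w = 2) := by
      ext x
      simp only [Finset.mem_univ, Finset.mem_insert, Finset.mem_union, Finset.mem_filter, true_and,
        true_iff]
      have h1 := hle v x
      have h2 := hno x
      rcases (show Γ.dist v x = 0 ∨ Γ.dist v x = 1 ∨ Γ.dist v x = 2 by omega) with h | h | h
      · exact Or.inl (hconn.dist_eq_zero_iff.1 h).symm
      · exact Or.inr (Or.inl (dist_eq_one_iff_adj.1 h))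
      · exact Or.inr (Or.inr h)
    have hV : Fintype.card V = 2 * p + 1 := by
      rw [← Finset.card_univ, hU, Finset.card_insert_of_notMem (by simp),
        Finset.card_union_of_disjoint, hreg, hcard, two_mul]
      rw [Finset.disjoint_left]
      intro y hy hy'
      simp only [Finset.mem_filter, Finset.mem_univ, true_and] at hy hy'
      rw [← dist_eq_one_iff_adj] at hy
      omega
    have hsum := Γ.sum_degrees_eq_twice_card_edges
    rw [Finset.sum_congr rfl (g := fun _ => p), Finset.sum_const, Finset.card_univ, hV,
      smul_eq_mul] at hsum
    · have h1 : Odd ((2 * p + 1) * p) := (odd_two_mul_add_one p).mul hp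
      rw [hsum] at h1
      exact (Nat.not_odd_iff_even.2 (even_two_mul _)) h1
    · intro x _
      rw [← hreg x, ← card_neighborFinset_eq_degree]
      congr 1
      ext y
      simp
  refine ⟨fun v => ?_, ?_⟩
  · obtain ⟨z, hz⟩ := hex v
    refine ⟨z, hz, fun z' hz' => ?_⟩
    by_contra hne
    obtain ⟨-, -, u, w, -, -, hwz⟩ := hconn.exists_of_dist_eq_three hz
    have hwv := (hadj v z hz w).1 hwz.symm
    have h2 : Γ.dist z z' = 2 := by
      rw [hconn.dist_eq_two_iff]
      refine ⟨hne, fun h => ?_, w, hwz.symm, ((hadj v z' hz' w).2 hwv).symm⟩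
      have := (hadj v z hz z').1 h
      simp only at hz'
      omega
    have h3 := hc z z' h2
    simp only [Γ.adj_comm _ z', hadj v z hz, hadj v z' hz', and_self, hcard] at h3
    omega
  · have := hconn.nonempty
    obtain ⟨a, b, hab⟩ := Γ.exists_dist_eq_diam
    obtain ⟨z, hz⟩ := hex a
    have h1 := dist_le_diam (connected_iff_ediam_ne_top.1 hconn) (u := a) (v := z)
    have h2 := hle a b
    omega

/-- An automorphism fixing a vertex acts on the graph induced on its neighbourhood. -/
def SimpleGraph.Iso.inducedOnNeighbors {V : Type*} {Γ : SimpleGraph V} (φ : Γ ≃g Γ) {u : V}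
    (hu : φ u = u) : Γ.induce (Γ.neighborSet u) ≃g Γ.induce (Γ.neighborSet u) where
  toEquiv := φ.toEquiv.subtypeEquiv fun x => by
    change Γ.Adj u x ↔ Γ.Adj u (φ x)
    conv_rhs => rw [← hu]
    exact φ.map_adj_iff.symm
  map_rel_iff' := φ.map_adj_iff

/-- An automorphism of a graph, as an automorphism of its complement. -/
def SimpleGraph.Iso.onCompl {V : Type*} {Γ : SimpleGraph V} (φ : Γ ≃g Γ) : Γᶜ ≃g Γᶜ where
  toEquiv := φ.toEquiv
  map_rel_iff' := by
    intro a b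
    simp [φ.map_adj_iff]

section TwoGeodesicTransitive

variable {V : Type*} {Γ : SimpleGraph V}

theorem ArcTransitive.exists_iso_induce (h : ArcTransitive Γ) {u : V} (x y : Γ.neighborSet u) :
    ∃ ψ : Γ.induce (Γ.neighborSet u) ≃g Γ.induce (Γ.neighborSet u), ψ x = y := by
  obtain ⟨φ, hu, hx⟩ := h x.2 y.2
  exact ⟨φ.inducedOnNeighbors hu, Subtype.ext hx⟩

theorem TwoGeodesicTransitive.arcTransitive_compl_induce (h : TwoGeodesicTransitive Γ) (u : V) :
    ArcTransitive (Γ.induce (Γ.neighborSet u))ᶜ := by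
  rintro ⟨a, ha⟩ ⟨b, hb⟩ ⟨a', ha'⟩ ⟨b', hb'⟩ hab hab'
  simp only [compl_adj, comap_adj, Function.Embedding.subtype_apply, ne_eq,
    Subtype.mk.injEq] at hab hab'
  obtain ⟨φ, h1, hu, h2⟩ := h.2 (v := a) (u := u) (w := b) (v' := a') (u' := u) (w' := b')
    ⟨ha.symm, hb, hab.1, hab.2⟩ ⟨ha'.symm, hb', hab'.1, hab'.2⟩
  exact ⟨(φ.inducedOnNeighbors hu).onCompl, Subtype.ext h1, Subtype.ext h2⟩

/-- A 2-geodesic transitive graph that is not 2-arc transitive has a triangle on each edge. -/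
theorem TwoGeodesicTransitive.exists_common_neighbor (h : TwoGeodesicTransitive Γ)
    (h2at : ¬ TwoArcTransitive Γ) {u x : V} (hux : Γ.Adj u x) : ∃ y, Γ.Adj u y ∧ Γ.Adj x y := by
  by_contra! hno
  refine h2at ⟨h.1, fun v a w v' a' w' harc harc' => ?_⟩
  have hgeo : ∀ v a w, Is2Arc Γ v a w → Is2Geodesic Γ v a w := by
    rintro v a w ⟨h1, h2, h3⟩
    refine ⟨h1, h2, h3, fun h4 => ?_⟩
    obtain ⟨φ, rfl, rfl⟩ := h.1 h1 hux
    exact hno (φ w) (φ.map_adj_iff.2 h4) (φ.map_adj_iff.2 h2)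
  exact h.2 (hgeo _ _ _ harc) (hgeo _ _ _ harc')

/-- In a connected arc transitive graph that is not complete, each vertex is the middle of a
2-geodesic. -/
theorem ArcTransitive.exists_two_geodesic (h : ArcTransitive Γ) (hconn : Γ.Connected)
    (hnc : Γ ≠ ⊤) {u x : V} (hux : Γ.Adj u x) :
    ∃ a b, Γ.Adj u a ∧ Γ.Adj u b ∧ a ≠ b ∧ ¬ Γ.Adj a b := by
  by_contra! hno
  have hno' : ∀ c a b, Γ.Adj c a → Γ.Adj c b → a ≠ b → Γ.Adj a b := by
    intro c a b hca hcb hab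
    obtain ⟨φ, rfl, rfl⟩ := h hca hux
    exact φ.map_adj_iff.1
      (hno _ _ (φ.map_adj_iff.2 hca) (φ.map_adj_iff.2 hcb) (φ.injective.ne hab))
  apply hnc
  ext a b
  rw [top_adj]
  refine ⟨fun h => h.ne, fun hab => ?_⟩
  have hr := hconn a b
  rw [reachable_iff_reflTransGen] at hr
  induction hr with
  | refl => exact absurd rfl hab
  | @tail c d _ hcd ih =>
    by_cases hac : a = c
    · rwa [hac]
    · exact hno' c a d (ih hac).symm hcd hab

end TwoGeodesicTransitive

theorem stmt11 {V : Type*} [Fintype V] (Γ : SimpleGraph V) (p : ℕ)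
    (hp : p.Prime)
    (hreg : ∀ v : V, Nat.card (Γ.neighborSet v) = p)
    (hconn : Γ.Connected)
    (hnc : Γ ≠ ⊤)
    (h2gt : TwoGeodesicTransitive Γ)
    (h2at : ¬ TwoArcTransitive Γ) :
    (∀ v : V, ∃! v' : V, Γ.dist v v' = 3) ∧ Γ.diam = 3 := by
  classical
  have : Fact p.Prime := ⟨hp⟩
  have hnbr : ∀ u, ∃ x, Γ.Adj u x := by
    intro u
    have h1 : 0 < Nat.card (Γ.neighborSet u) := by rw [hreg]; exact hp.pos
    obtain ⟨⟨x, hx⟩⟩ := (Nat.card_pos_iff.1 h1).1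
    exact ⟨x, hx⟩
  have hreg' : ∀ v, (Finset.univ.filter fun y => Γ.Adj v y).card = p := by
    intro v
    rw [← hreg v, Nat.card_eq_fintype_card, Fintype.card_subtype]
    rfl
  have hcompl (u : V) (x y : Γ.neighborSet u) :
      ∃ ψ : (Γ.induce (Γ.neighborSet u))ᶜ ≃g (Γ.induce (Γ.neighborSet u))ᶜ, ψ x = y := by
    obtain ⟨ψ, hψ⟩ := h2gt.1.exists_iso_induce x y
    exact ⟨ψ.onCompl, hψ⟩
  have hbot (u : V) : Γ.induce (Γ.neighborSet u) ≠ ⊥ := by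
    obtain ⟨x, hx⟩ := hnbr u
    obtain ⟨y, hy, hxy⟩ := h2gt.exists_common_neighbor h2at hx
    rw [ne_bot_iff_exists_adj]
    exact ⟨⟨x, hx⟩, ⟨y, hy⟩, hxy⟩
  have htop (u : V) : Γ.induce (Γ.neighborSet u) ≠ ⊤ := by
    obtain ⟨x, hx⟩ := hnbr u
    obtain ⟨a, b, ha, hb, hab, hnadj⟩ := h2gt.1.exists_two_geodesic hconn hnc hx
    intro h
    have h1 : (Γ.induce (Γ.neighborSet u)).Adj ⟨a, ha⟩ ⟨b, hb⟩ := by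
      rw [h, top_adj]
      exact fun e => hab (congrArg Subtype.val e)
    exact hnadj h1
  have hloc (u : V) (W : Set V) (hW : ∀ x ∈ W, Γ.Adj u x → ∀ y, Γ.Adj u y → Γ.Adj x y → y ∈ W)
      (x : V) (hx : x ∈ W) (hux : Γ.Adj u x) (y : V) (huy : Γ.Adj u y) : y ∈ W :=
    mem_of_adj_mem (hreg u) h2gt.1.exists_iso_induce (hbot u) (W := Subtype.val ⁻¹' W)
      (fun a ha b hab => hW a ha a.2 b b.2 hab) (x := ⟨x, hux⟩) hx ⟨y, huy⟩
  have htwin (u x y : V) (hx : Γ.Adj u x) (hy : Γ.Adj u y) (hxy : Γ.Adj x y) :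
      ∃ z, Γ.Adj u z ∧ z ≠ y ∧ Γ.Adj x z ∧ ¬ Γ.Adj y z := by
    obtain ⟨z, hzy, hxz, hyz⟩ := exists_adj_not_adj (hreg u) h2gt.1.exists_iso_induce (htop u)
      (x := ⟨x, hx⟩) (y := ⟨y, hy⟩) hxy
    exact ⟨z, z.2, fun h => hzy (Subtype.ext h), hxz, hyz⟩
  have htwin' (u x y : V) (hx : Γ.Adj u x) (hy : Γ.Adj u y) (hne : x ≠ y) (hxy : ¬ Γ.Adj x y) :
      ∃ z, z ≠ y ∧ ¬ Γ.Adj x z ∧ Γ.Adj y z := by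
    obtain ⟨z, hzy, hxz, hyz⟩ := exists_adj_not_adj (hreg u) (hcompl u)
      (by rw [ne_eq, compl_eq_top]; exact hbot u) (x := ⟨x, hx⟩) (y := ⟨y, hy⟩)
      ⟨fun e => hne (congrArg Subtype.val e), hxy⟩
    rw [compl_adj, not_and_not_right] at hyz
    exact ⟨z, fun h => hzy (Subtype.ext h), hxz.2, hyz hzy.symm⟩
  have hpar (u : V) : ∃ k, 0 < k ∧ k < p - 1 ∧ k ∣ p - 1 ∧
      (∀ x, Γ.Adj u x → (Finset.univ.filter fun y => Γ.Adj u y ∧ y ≠ x ∧ ¬ Γ.Adj x y).card = k) ∧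
      ∀ x y, Γ.Adj u x → Γ.Adj u y → x ≠ y → ¬ Γ.Adj x y →
        p ≤ (Finset.univ.filter fun z => Γ.Adj u z ∧ Γ.Adj x z ∧ Γ.Adj y z).card + 2 * k ∧
        (2 * k + 1 = p →
          k = 2 * (Finset.univ.filter fun z => Γ.Adj u z ∧ Γ.Adj x z ∧ Γ.Adj y z).card) := by
    obtain ⟨k, hk0, hkp, hdvd, hk, hM⟩ := (h2gt.arcTransitive_compl_induce u).exists_valency
      (hreg u) (hcompl u) (by rw [ne_eq, compl_eq_bot]; exact htop u)
      (by rw [ne_eq, compl_eq_top]; exact hbot u)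
    refine ⟨k, hk0, hkp, hdvd, fun x hx => ?_, fun x y hx hy hne hxy => ?_⟩
    · rw [← hk ⟨x, hx⟩, ← Finset.card_map (Function.Embedding.subtype _)]
      congr 1
      ext y
      simp only [Finset.mem_filter, Finset.mem_univ, true_and, Finset.mem_map,
        Function.Embedding.subtype_apply]
      constructor
      · rintro ⟨huy, hyx, hxy⟩
        exact ⟨⟨y, huy⟩, ⟨fun e => hyx (congrArg Subtype.val e).symm, hxy⟩, rfl⟩
      · rintro ⟨z, hz, rfl⟩
        exact ⟨z.2, fun e => hz.1 (Subtype.ext e.symm), hz.2⟩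
    · have h1 := hM ⟨x, hx⟩ ⟨y, hy⟩ ⟨fun e => hne (congrArg Subtype.val e), hxy⟩
      have h2 : (Finset.univ.filter fun z => Γ.Adj u z ∧ Γ.Adj x z ∧ Γ.Adj y z) =
          (Finset.univ.filter fun z => (Γ.induce (Γ.neighborSet u))ᶜᶜ.Adj ⟨x, hx⟩ z ∧
            (Γ.induce (Γ.neighborSet u))ᶜᶜ.Adj ⟨y, hy⟩ z).map (Function.Embedding.subtype _) := by
        ext z
        simp [and_comm, and_left_comm]
      rw [h2, Finset.card_map]
      convert h1
  obtain ⟨v₀⟩ := hconn.nonempty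
  obtain ⟨u₀, hvu₀⟩ := hnbr v₀
  obtain ⟨k, hk0, hkp, hdvd, hk₀, -⟩ := hpar v₀
  have hk (u x : V) (hux : Γ.Adj u x) :
      (Finset.univ.filter fun y => Γ.Adj u y ∧ y ≠ x ∧ ¬ Γ.Adj x y).card = k := by
    obtain ⟨φ, rfl, rfl⟩ := h2gt.1 hux hvu₀
    rw [← hk₀ _ hvu₀]
    refine Finset.card_equiv φ.toEquiv fun y => ?_
    simp [φ.map_adj_iff]
  have hM (u x y : V) (hx : Γ.Adj u x) (hy : Γ.Adj u y) (hne : x ≠ y) (hxy : ¬ Γ.Adj x y) :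
        p ≤ (Finset.univ.filter fun z => Γ.Adj u z ∧ Γ.Adj x z ∧ Γ.Adj y z).card + 2 * k ∧
        (2 * k + 1 = p →
          k = 2 * (Finset.univ.filter fun z => Γ.Adj u z ∧ Γ.Adj x z ∧ Γ.Adj y z).card) := by
    obtain ⟨k', -, -, -, hk', hM'⟩ := hpar u
    obtain rfl : k' = k := by rw [← hk' x hx, hk u x hx]
    exact hM' x y hx hy hne hxy
  obtain ⟨a, b, ha, hb, hab, hnadj⟩ := h2gt.1.exists_two_geodesic hconn hnc hvu₀
  obtain ⟨c, hc⟩ : ∃ c, (Finset.univ.filter fun y => Γ.Adj a y ∧ Γ.Adj y b).card = c := ⟨_, rfl⟩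
  have hc' (v w : V) (hvw : Γ.dist v w = 2) :
      (Finset.univ.filter fun y => Γ.Adj v y ∧ Γ.Adj y w).card = c := by
    obtain ⟨hne, hadj, u, hvu, huw⟩ := hconn.dist_eq_two_iff.1 hvw
    obtain ⟨φ, rfl, rfl, rfl⟩ := h2gt.2 (v' := a) (u' := v₀) (w' := b)
      ⟨hvu, huw, hne.symm, hadj⟩ ⟨ha.symm, hb, hab, hnadj⟩
    rw [← hc]
    refine Finset.card_equiv φ.toEquiv fun y => ?_
    simp [φ.map_adj_iff]
  have hcount := mul_eq_card_dist_two_mul hreg' hconn hk hc' a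
  have hcp : c < p := by
    obtain ⟨z, hzb, haz, hbz⟩ := htwin' v₀ a b ha hb hab hnadj
    rw [← hc, ← hreg' b]
    refine Finset.card_lt_card ⟨fun y hy => ?_, fun h => ?_⟩
    · simp only [Finset.mem_filter, Finset.mem_univ, true_and] at hy ⊢
      exact hy.2.symm
    · have := h (Finset.mem_filter.2 ⟨Finset.mem_univ z, hbz⟩)
      simp only [Finset.mem_filter, Finset.mem_univ, true_and] at this
      exact haz this.1
  obtain ⟨hM1, hM2⟩ := hM v₀ a b ha hb hab hnadj
  have hMc : (Finset.univ.filter fun z => Γ.Adj v₀ z ∧ Γ.Adj a z ∧ Γ.Adj b z).card < c := by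
    rw [← hc]
    refine Finset.card_lt_card ⟨fun y hy => ?_, fun h => ?_⟩
    · simp only [Finset.mem_filter, Finset.mem_univ, true_and] at hy ⊢
      exact ⟨hy.2.1, hy.2.2.symm⟩
    · have := h (Finset.mem_filter.2 ⟨Finset.mem_univ v₀, ha.symm, hb⟩)
      simp at this
  have hck : c ∣ k := by
    have hcop : Nat.Coprime c p :=
      ((Nat.Prime.coprime_iff_not_dvd hp).2 (Nat.not_dvd_of_pos_of_lt (by omega) hcp)).symm
    exact hcop.dvd_of_dvd_mul_left ⟨_, hcount.trans (mul_comm _ _)⟩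
  have hkc := Nat.le_of_dvd hk0 hck
  have hpk : 2 * k + 1 = p := by
    obtain ⟨j, hj⟩ := hdvd
    have hj1 : j ≠ 0 := by rintro rfl; omega
    have hj2 : j ≠ 1 := by rintro rfl; omega
    have hj3 : j < 3 := by
      by_contra! h3
      have := Nat.mul_le_mul_left k h3
      omega
    obtain rfl : j = 2 := by omega
    omega
  have hM3 := hM2 hpk
  obtain rfl : c = k := by
    obtain ⟨j, hj⟩ := hck
    have hj1 : j ≠ 0 := by rintro rfl; omega
    have hj2 : j < 2 := by
      by_contra! h2
      have := Nat.mul_le_mul_left c h2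
      omega
    obtain rfl : j = 1 := by omega
    omega
  refine existsUnique_dist_eq_three_and_diam ⟨c, hpk.symm⟩ hreg' hconn hk0 (by omega) hk hc' ?_
  exact fun v z hz y => adj_iff_dist_eq_two hreg' hconn hk0 hk hc' htwin hloc hz y
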